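/- arXiv:1909.06829 — 2 statements merged into one kernel-verified Lean document; each statement's English description precedes it below -/
import Mathlib

section
/- Let (u_i)_{i∈I} be a well complemented block basic sequence with respect to an unconditional basis (x_j)_{j∈J} of a real Banach space X, with good projecting functionals (u_i*)_{i∈I}. Let (v_i)_{i∈I} be vectors in X and (v_i*)_{i∈I} functionals in X* such that for some constant C > 0: (i) |x_j*(v_i)| ≤ C |x_j*(u_i)| for all (i,j) ∈ I × J; (ii) |v_i*(x_j)| ≤ C |u_i*(x_j)| for all (i,j) ∈ I × J; and (iii) inf_{i∈I} |v_i*(v_i)| > 0. Then (v_i)_{i∈I} is a well complemented block basic sequence equivalent to (u_i)_{i∈I}. Moreover, if v_i*(v_i) = 1 and supp(v_i*) ⊆ supp(v_i) for all i ∈ I, then (v_i*)_{i∈I} is a sequence of good projecting functionals for (v_i)_{i∈I}. -/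
open scoped Classical

noncomputable section

variable {X : Type*} [NormedAddCommGroup X] [NormedSpace ℝ X]

/-- The closed linear span of a family of vectors. -/
def closedSpan {J : Type*} (x : J → X) : Submodule ℝ X :=
  (Submodule.span ℝ (Set.range x)).topologicalClosure

theorem mem_closedSpan {J : Type*} (x : J → X) (j : J) : x j ∈ closedSpan x :=
  Submodule.le_topologicalClosure _ (Submodule.subset_span ⟨j, rfl⟩)

/-- Two families of vectors (with the same index set) are equivalent if the correspondence
`u_i ↦ v_i` extends to a linear homeomorphism between their closed linear spans. -/
def FamiliesEquivalent {J : Type*} {Y : Type*} [NormedAddCommGroup Y] [NormedSpace ℝ Y]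
    (x : J → X) (y : J → Y) : Prop :=
  ∃ T : closedSpan x ≃L[ℝ] closedSpan y,
    ∀ j : J, (T ⟨x j, mem_closedSpan x j⟩ : Y) = y j

/-- The support of a vector with respect to a basis with coefficient functionals `xstar`. -/
def Supp {J : Type*} (xstar : J → (X →L[ℝ] ℝ)) (f : X) : Set J :=
  {j | xstar j f ≠ 0}

/-- The support of a functional with respect to a basis `x`. -/
def SuppStar {J : Type*} (x : J → X) (g : X →L[ℝ] ℝ) : Set J :=
  {j | g (x j) ≠ 0}

/-- A block basic sequence with respect to a basis with coefficient functionals `xstar`: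
nonzero vectors with finite, pairwise disjoint supports. -/
def IsBlockBasic {J I : Type*} (xstar : J → (X →L[ℝ] ℝ)) (u : I → X) : Prop :=
  (∀ i, u i ≠ 0) ∧ (∀ i, (Supp xstar (u i)).Finite) ∧
    Pairwise fun i k => Disjoint (Supp xstar (u i)) (Supp xstar (u k))

/-- `ustar` is a family of good projecting functionals for the block basic sequence `u`:
biorthogonal functionals supported in the supports of the `u i` such that
`f ↦ Σ_i ustar i (f) • u i` is a well-defined bounded linear operator on `X`. -/
def IsGoodProjecting {J I : Type*} (x : J → X) (xstar : J → (X →L[ℝ] ℝ))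
    (u : I → X) (ustar : I → (X →L[ℝ] ℝ)) : Prop :=
  (∀ i, SuppStar x (ustar i) ⊆ Supp xstar (u i)) ∧
  (∀ i k, ustar i (u k) = if i = k then 1 else 0) ∧
  ∃ P : X →L[ℝ] X, ∀ f, HasSum (fun i => ustar i f • u i) (P f)

theorem aux_finset_bound {J : Type*} (a : J → X) (l : J → ℝ) (c B : ℝ) (t : Finset J)
    (hc : 0 ≤ c) (hl : ∀ j, |l j| ≤ c) (hB : ∀ s ⊆ t, ‖∑ j ∈ s, a j‖ ≤ B) :
    ‖∑ j ∈ t, l j • a j‖ ≤ 2 * c * B := by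
  have hB0 : 0 ≤ B := (norm_nonneg _).trans (hB ∅ (Finset.empty_subset _))
  obtain ⟨g, hg1, hg2⟩ := exists_dual_vector'' ℝ (∑ j ∈ t, l j • a j)
  have hgs : ∀ s ⊆ t, |∑ j ∈ s, g (a j)| ≤ B := by
    intro s hs
    rw [← map_sum, ← Real.norm_eq_abs]
    calc ‖g (∑ j ∈ s, a j)‖ ≤ ‖g‖ * ‖∑ j ∈ s, a j‖ := g.le_opNorm _
      _ ≤ 1 * B := by gcongr; exact hB s hs
      _ = B := one_mul B
  have habs : ∑ j ∈ t, |g (a j)| ≤ 2 * B := by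
    rw [← Finset.sum_filter_add_sum_filter_not t (fun j => 0 ≤ g (a j))]
    have e1 : ∑ j ∈ t with 0 ≤ g (a j), |g (a j)| = ∑ j ∈ t with 0 ≤ g (a j), g (a j) :=
      Finset.sum_congr rfl fun j hj => abs_of_nonneg (Finset.mem_filter.1 hj).2
    have e2 : ∑ j ∈ t with ¬ 0 ≤ g (a j), |g (a j)| = - ∑ j ∈ t with ¬ 0 ≤ g (a j), g (a j) := by
      rw [← Finset.sum_neg_distrib]
      exact Finset.sum_congr rfl fun j hj =>
        abs_of_neg (not_le.1 (Finset.mem_filter.1 hj).2)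
    rw [e1, e2]
    have b1 := abs_le.1 (hgs _ (Finset.filter_subset (fun j => 0 ≤ g (a j)) t))
    have b2 := abs_le.1 (hgs _ (Finset.filter_subset (fun j => ¬ 0 ≤ g (a j)) t))
    linarith [b1.2, b2.1]
  have h : ‖∑ j ∈ t, l j • a j‖ = ∑ j ∈ t, l j * g (a j) := by
    have h2 : g (∑ j ∈ t, l j • a j) = ‖∑ j ∈ t, l j • a j‖ := by simpa using hg2
    rw [← h2, map_sum]
    simp
  rw [h]
  calc ∑ j ∈ t, l j * g (a j) ≤ ∑ j ∈ t, c * |g (a j)| := by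
        refine Finset.sum_le_sum fun j _ => ?_
        calc l j * g (a j) ≤ |l j * g (a j)| := le_abs_self _
          _ = |l j| * |g (a j)| := abs_mul _ _
          _ ≤ c * |g (a j)| := by gcongr; exact hl j
    _ = c * ∑ j ∈ t, |g (a j)| := by rw [Finset.mul_sum]
    _ ≤ c * (2 * B) := by gcongr
    _ = 2 * c * B := by ring

theorem aux_summable [CompleteSpace X] {J : Type*} (a : J → X) (l : J → ℝ) (c : ℝ)
    (hl : ∀ j, |l j| ≤ c) (hc : 0 ≤ c) (ha : Summable a) : Summable fun j => l j • a j := by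
  rw [summable_iff_vanishing_norm] at ha ⊢
  intro ε hε
  obtain ⟨s, hs⟩ := ha (ε / (2 * c + 1)) (by positivity)
  refine ⟨s, fun t ht => ?_⟩
  have := aux_finset_bound a l c (ε / (2 * c + 1)) t hc hl
    (fun t' ht' => (hs t' (Finset.disjoint_of_subset_left ht' ht)).le)
  refine this.trans_lt ?_
  rw [mul_div_assoc', div_lt_iff₀ (by positivity)]
  nlinarith

theorem aux_ext {J : Type*} (x : J → X) (xstar : J → (X →L[ℝ] ℝ))
    (hexp : ∀ f : X, HasSum (fun j => xstar j f • x j) f) {f g : X}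
    (h : ∀ j, xstar j f = xstar j g) : f = g := by
  have h1 := hexp f
  simp only [h] at h1
  exact h1.unique (hexp g)

theorem aux_biorth {J : Type*} (x : J → X) (xstar : J → (X →L[ℝ] ℝ))
    (hbasis : ∀ f : X, ∃! a : J → ℝ, HasSum (fun j => a j • x j) f)
    (hexp : ∀ f : X, HasSum (fun j => xstar j f • x j) f) (j k : J) :
    xstar j (x k) = if j = k then 1 else 0 := by
  have h1 : HasSum (fun j => (if j = k then (1 : ℝ) else 0) • x j) (x k) := by
    have := hasSum_single (f := fun j => (if j = k then (1 : ℝ) else 0) • x j) k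
      (by intro b hb; simp [hb])
    simpa using this
  exact congrFun ((hbasis (x k)).unique (hexp (x k)) h1) j

theorem aux_mult [CompleteSpace X] {J : Type*} (x : J → X) (xstar : J → (X →L[ℝ] ℝ))
    (hbasis : ∀ f : X, ∃! a : J → ℝ, HasSum (fun j => a j • x j) f)
    (hexp : ∀ f : X, HasSum (fun j => xstar j f • x j) f)
    (l : J → ℝ) (c : ℝ) (hc : 0 ≤ c) (hl : ∀ j, |l j| ≤ c) :
    ∃ M : X →L[ℝ] X, ∀ j f, xstar j (M f) = l j * xstar j f := by
  have hs : ∀ f, Summable fun j => l j • xstar j f • x j :=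
    fun f => aux_summable _ l c hl hc (hexp f).summable
  let M₀ : X →ₗ[ℝ] X :=
    { toFun := fun f => ∑' j, l j • xstar j f • x j
      map_add' := by
        intro f g
        rw [← (hs f).tsum_add (hs g)]
        refine tsum_congr fun j => ?_
        rw [map_add, add_smul, smul_add]
      map_smul' := by
        intro r f
        rw [RingHom.id_apply, ← (hs f).tsum_const_smul r]
        refine tsum_congr fun j => ?_
        rw [map_smul, smul_smul, smul_smul, smul_smul, smul_eq_mul]
        ring_nf }
  have hM : ∀ j f, xstar j (M₀ f) = l j * xstar j f := by
    intro j f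
    have h1 : HasSum (fun j => (l j * xstar j f) • x j) (M₀ f) := by
      have h2 : HasSum (fun j => l j • xstar j f • x j) (M₀ f) := (hs f).hasSum
      simpa only [smul_smul] using h2
    exact congrFun ((hbasis (M₀ f)).unique (hexp (M₀ f)) h1) j
  have hcont : Continuous M₀ := by
    refine M₀.continuous_of_seq_closed_graph ?_
    intro w f g hw hg
    refine aux_ext x xstar hexp fun j => ?_
    rw [hM]
    have t1 := ((xstar j).continuous.tendsto g).comp hg
    have t2 := (((xstar j).continuous.tendsto f).comp hw).const_mul (l j)
    refine tendsto_nhds_unique t1 (t2.congr fun n => ?_)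
    simp [hM]
  exact ⟨⟨M₀, hcont⟩, hM⟩

theorem aux_glue {J I : Type*} (A : I → Set J) (hA : Pairwise fun i k => Disjoint (A i) (A k))
    (w : I → J → ℝ) (c : ℝ) (hc : 0 ≤ c) (hw : ∀ i, ∀ j ∈ A i, |w i j| ≤ c) :
    ∃ l : J → ℝ, (∀ j, |l j| ≤ c) ∧ ∀ i, ∀ j ∈ A i, l j = w i j := by
  refine ⟨fun j => if h : ∃ i, j ∈ A i then w h.choose j else 0, ?_, ?_⟩
  · intro j
    by_cases h : ∃ i, j ∈ A i
    · simpa only [dif_pos h] using hw _ j h.choose_spec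
    · simpa only [dif_neg h, abs_zero] using hc
  · intro i j hj
    have h : ∃ i, j ∈ A i := ⟨i, hj⟩
    simp only [dif_pos h]
    have : h.choose = i := by
      by_contra hne
      exact Set.disjoint_left.1 (hA hne) h.choose_spec hj
    rw [this]

theorem aux_maps {I : Type*} (u v : I → X) (A : X →L[ℝ] X) (h : ∀ i, A (u i) = v i) :
    ∀ f ∈ closedSpan u, A f ∈ closedSpan v := by
  have hle : closedSpan u ≤ (closedSpan v).comap (A : X →ₗ[ℝ] X) := by
    refine Submodule.topologicalClosure_minimal _ ?_ ?_
    · rw [Submodule.span_le]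
      rintro _ ⟨i, rfl⟩
      change A (u i) ∈ closedSpan v
      rw [h]
      exact mem_closedSpan v i
    · exact (Submodule.isClosed_topologicalClosure (Submodule.span ℝ (Set.range v))).preimage
        A.continuous
  exact fun f hf => hle hf

theorem aux_inv {I : Type*} (u : I → X) (A : X →L[ℝ] X) (h : ∀ i, A (u i) = u i) :
    ∀ f ∈ closedSpan u, A f = f := by
  have hle : closedSpan u ≤ LinearMap.ker ((A - ContinuousLinearMap.id ℝ X : X →L[ℝ] X) : X →ₗ[ℝ] X) := by
    refine Submodule.topologicalClosure_minimal _ ?_ ?_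
    · rw [Submodule.span_le]
      rintro _ ⟨i, rfl⟩
      simp [h]
    · exact ContinuousLinearMap.isClosed_ker (A - ContinuousLinearMap.id ℝ X)
  intro f hf
  have := hle hf
  simpa [sub_eq_zero] using this

theorem aux_equiv {I : Type*} (u v : I → X) (A B : X →L[ℝ] X) (hA : ∀ i, A (u i) = v i)
    (hB : ∀ i, B (v i) = u i) : FamiliesEquivalent u v := by
  refine ⟨ContinuousLinearEquiv.equivOfInverse
    ((A.comp (closedSpan u).subtypeL).codRestrict (closedSpan v)
      fun f => aux_maps u v A hA f f.2)
    ((B.comp (closedSpan v).subtypeL).codRestrict (closedSpan u)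
      fun f => aux_maps v u B hB f f.2) ?_ ?_, ?_⟩
  · intro f
    apply Subtype.ext
    exact aux_inv u (B.comp A) (fun i => by simp [hA, hB]) f f.2
  · intro f
    apply Subtype.ext
    exact aux_inv v (A.comp B) (fun i => by simp [hA, hB]) f f.2
  · intro j
    exact hA j

/-- Let `(u_i)` be a well complemented block basic sequence with respect to
an unconditional basis `(x_j)` of `X`, with good projecting functionals `(u_i*)`. If `(v_i)`
and `(v_i*)` satisfy `|x_j*(v_i)| ≤ C |x_j*(u_i)|`, `|v_i*(x_j)| ≤ C |u_i*(x_j)|` and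
`inf_i |v_i*(v_i)| > 0`, then `(v_i)` is a well complemented block basic sequence equivalent
to `(u_i)`; moreover if `v_i*(v_i) = 1` and `supp v_i* ⊆ supp v_i` for all `i`, then `(v_i*)`
is a family of good projecting functionals for `(v_i)`. -/
theorem well_complemented_block_basic_perturbation
    [CompleteSpace X] {J I : Type*}
    (x : J → X) (xstar : J → (X →L[ℝ] ℝ))
    (hbasis : ∀ f : X, ∃! a : J → ℝ, HasSum (fun j => a j • x j) f)
    (hexp : ∀ f : X, HasSum (fun j => xstar j f • x j) f)
    (u : I → X) (ustar : I → (X →L[ℝ] ℝ))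
    (hu : IsBlockBasic xstar u) (hust : IsGoodProjecting x xstar u ustar)
    (v : I → X) (vstar : I → (X →L[ℝ] ℝ)) (C : ℝ) (hC : 0 < C)
    (h₁ : ∀ i j, |xstar j (v i)| ≤ C * |xstar j (u i)|)
    (h₂ : ∀ i j, |vstar i (x j)| ≤ C * |ustar i (x j)|)
    (h₃ : ∃ ε > 0, ∀ i, ε ≤ |vstar i (v i)|) :
    (IsBlockBasic xstar v ∧
      (∃ vstar' : I → (X →L[ℝ] ℝ), IsGoodProjecting x xstar v vstar') ∧
      FamiliesEquivalent u v) ∧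
    ((∀ i, vstar i (v i) = 1) → (∀ i, SuppStar x (vstar i) ⊆ Supp xstar (v i)) →
      IsGoodProjecting x xstar v vstar) := by
  obtain ⟨hu0, hufin, hudisj⟩ := hu
  obtain ⟨hus, hubi, P, hP⟩ := hust
  obtain ⟨ε, hε, hvv⟩ := h₃
  have hx := aux_biorth x xstar hbasis hexp
  have hvne : ∀ i, vstar i (v i) ≠ 0 := fun i h => by
    have := hvv i
    rw [h, abs_zero] at this
    linarith
  have hsub : ∀ i, Supp xstar (v i) ⊆ Supp xstar (u i) := by
    intro i j hj hj'
    apply hj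
    have := h₁ i j
    rw [hj', abs_zero, mul_zero] at this
    exact abs_eq_zero.1 (le_antisymm this (abs_nonneg _))
  have hblock : IsBlockBasic xstar v := by
    refine ⟨fun i h => hvne i (by rw [h, map_zero]), fun i => (hufin i).subset (hsub i), ?_⟩
    intro i k hik
    exact Set.disjoint_of_subset (hsub i) (hsub k) (hudisj hik)
  have hgz : ∀ i j, ustar i (x j) = 0 → vstar i (x j) = 0 := by
    intro i j hj
    have := h₂ i j
    rw [hj, abs_zero, mul_zero] at this
    exact abs_eq_zero.1 (le_antisymm this (abs_nonneg _))
  -- expansion of functionals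
  have hfun : ∀ (g : X →L[ℝ] ℝ) f, HasSum (fun j => xstar j f * g (x j)) (g f) := by
    intro g f
    have := g.hasSum (hexp f)
    simpa using this
  have hMx : ∀ (M : X →L[ℝ] X) (l : J → ℝ), (∀ j f, xstar j (M f) = l j * xstar j f) →
      ∀ j, M (x j) = l j • x j := by
    intro M l hM j
    refine aux_ext x xstar hexp fun k => ?_
    rw [hM, map_smul, hx, smul_eq_mul]
    by_cases hkj : k = j
    · rw [hkj]
    · simp [hkj]
  -- the multiplier sending u to v
  obtain ⟨l, hlb, hl⟩ := aux_glue (fun i => Supp xstar (u i)) hudisj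
    (fun i j => xstar j (v i) / xstar j (u i)) C hC.le (by
      intro i j hj
      rw [abs_div, div_le_iff₀ (abs_pos.2 hj)]
      exact h₁ i j)
  obtain ⟨L, hL⟩ := aux_mult x xstar hbasis hexp l C hC.le hlb
  have hLu : ∀ i, L (u i) = v i := by
    intro i
    refine aux_ext x xstar hexp fun j => ?_
    rw [hL]
    by_cases hj : j ∈ Supp xstar (u i)
    · rw [hl i j hj]
      exact div_mul_cancel₀ _ hj
    · have h1 : xstar j (u i) = 0 := not_not.1 hj
      have h2 : xstar j (v i) = 0 := not_not.1 fun h => hj (hsub i h)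
      rw [h1, h2, mul_zero]
  have hsum : ∀ (N : X →L[ℝ] X) (w : I → (X →L[ℝ] ℝ)), (∀ i f, w i f = ustar i (N f)) →
      ∃ P : X →L[ℝ] X, ∀ f, HasSum (fun i => w i f • v i) (P f) := by
    intro N w hw
    refine ⟨L.comp (P.comp N), fun f => ?_⟩
    have := L.hasSum (hP (N f))
    simpa [hLu, hw] using this
  have hbi : ∀ w : I → (X →L[ℝ] ℝ), (∀ i, SuppStar x (w i) ⊆ Supp xstar (v i)) →
      (∀ i, w i (v i) = 1) → ∀ i k, w i (v k) = if i = k then 1 else 0 := by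
    intro w hw hw1 i k
    by_cases hik : i = k
    · subst hik
      simp [hw1]
    · rw [if_neg hik]
      refine (hfun (w i) (v k)).unique ?_
      have hz : (fun j => xstar j (v k) * w i (x j)) = fun _ => 0 := by
        funext j
        by_contra hne
        have h1 : j ∈ Supp xstar (v k) := left_ne_zero_of_mul hne
        have h2 : j ∈ Supp xstar (v i) := hw i (right_ne_zero_of_mul hne)
        exact Set.disjoint_left.1 (hblock.2.2 hik) h2 h1
      rw [hz]
      exact hasSum_zero
  have hfext : ∀ g h : X →L[ℝ] ℝ, (∀ j, g (x j) = h (x j)) → ∀ f, g f = h f := by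
    intro g h hgh f
    have h1 := hfun g f
    simp only [hgh] at h1
    exact h1.unique (hfun h f)
  refine ⟨⟨hblock, ?_⟩, ?_⟩
  · obtain ⟨n, hnb, hn⟩ := aux_glue (fun i => Supp xstar (u i)) hudisj
      (fun i j => if j ∈ Supp xstar (v i) then
        vstar i (x j) / ustar i (x j) / vstar i (v i) else 0) (C / ε) (by positivity) (by
        intro i j _
        split_ifs
        · rw [abs_div, abs_div]
          refine div_le_div₀ hC.le ?_ hε (hvv i)
          exact div_le_of_le_mul₀ (abs_nonneg _) hC.le (h₂ i j)
        · rw [abs_zero]; positivity)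
    obtain ⟨N, hN⟩ := aux_mult x xstar hbasis hexp n (C / ε) (by positivity) hnb
    have hNx := hMx N n hN
    have key : ∀ i j, ((ustar i).comp N) (x j) =
        if j ∈ Supp xstar (v i) then vstar i (x j) / vstar i (v i) else 0 := by
      intro i j
      rw [ContinuousLinearMap.comp_apply, hNx, map_smul, smul_eq_mul]
      by_cases h0 : ustar i (x j) = 0
      · rw [h0, hgz i j h0]
        simp
      · rw [hn i j (hus i h0)]
        split_ifs
        · field_simp
        · simp
    have hs : ∀ i, SuppStar x ((ustar i).comp N) ⊆ Supp xstar (v i) := by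
      intro i j hj
      by_contra hne
      apply hj
      rw [key, if_neg hne]
    have h1 : ∀ i, ((ustar i).comp N) (v i) = 1 := by
      intro i
      refine (hfun _ (v i)).unique ?_
      have h2 := (hfun (vstar i) (v i)).div_const (vstar i (v i))
      rw [div_self (hvne i)] at h2
      have h4 : (fun j => xstar j (v i) * ((ustar i).comp N) (x j)) =
          fun j => xstar j (v i) * vstar i (x j) / vstar i (v i) := ?_
      · rw [h4]
        exact h2
      funext j
      rw [key]
      split_ifs with h
      · rw [mul_div_assoc]
      · rw [show xstar j (v i) = 0 from not_not.1 h]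
        simp
    have hb := hbi _ hs h1
    refine ⟨⟨fun i => (ustar i).comp N, hs, hb, hsum N _ fun i f => rfl⟩, ?_⟩
    refine aux_equiv u v L (P.comp N) hLu fun k => ?_
    refine (hP (N (v k))).unique ?_
    have : ∀ i, ustar i (N (v k)) = if i = k then 1 else 0 := fun i => hb i k
    have h3 := hasSum_single (f := fun i => ustar i (N (v k)) • u i) k
      (by intro i hi; simp [this, hi])
    simpa [this] using h3
  · intro hv1 hvs
    refine ⟨hvs, hbi vstar hvs hv1, ?_⟩
    obtain ⟨m, hmb, hm⟩ := aux_glue (fun i => Supp xstar (u i)) hudisj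
      (fun i j => vstar i (x j) / ustar i (x j)) C hC.le (by
        intro i j _
        rw [abs_div]
        exact div_le_of_le_mul₀ (abs_nonneg _) hC.le (h₂ i j))
    obtain ⟨M, hM⟩ := aux_mult x xstar hbasis hexp m C hC.le hmb
    have hMx' := hMx M m hM
    refine hsum M vstar fun i => hfext (vstar i) ((ustar i).comp M) fun j => ?_
    rw [ContinuousLinearMap.comp_apply, hMx', map_smul, smul_eq_mul]
    by_cases h0 : ustar i (x j) = 0
    · rw [h0, hgz i j h0, mul_zero]
    · rw [hm i j (hus i h0)]
      exact (div_mul_cancel₀ _ h0).symm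

end
end

section
/- Let (X_i)_{i∈F} be a finite family of real Banach spaces and, for each i ∈ F, let B_i be an unconditional basis of X_i which is universal for well complemented block basic sequences. Then the direct-sum basis B = ⨁_{i∈F} B_i of X = ⨁_{i∈F} X_i is universal for well complemented block basic sequences. -/
open scoped Classical ENNReal

noncomputable section

variable {X : Type*} [NormedAddCommGroup X] [NormedSpace ℝ X]

/-- A family of vectors is semi-normalized if the norms of its members are bounded away
from `0` and from `∞`. -/
def SemiNormalized {I : Type*} (u : I → X) : Prop :=
  ∃ c C : ℝ, 0 < c ∧ ∀ i, c ≤ ‖u i‖ ∧ ‖u i‖ ≤ C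

/-- An unconditional basis of `X`, bundled with its coefficient functionals. -/
structure UncondBasis (X : Type*) [NormedAddCommGroup X] [NormedSpace ℝ X]
    (J : Type*) where
  vec : J → X
  coef : J → (X →L[ℝ] ℝ)
  expansion : ∀ f : X, HasSum (fun j => coef j f • vec j) f
  unique : ∀ (f : X) (a : J → ℝ), HasSum (fun j => a j • vec j) f → a = fun j => coef j f

/-- A basis is universal for well complemented block basic sequences if every semi-normalized
well complemented block basic sequence with respect to it is equivalent to a subfamily
`(x_{π(i)})_i` with `π` injective and `π i` in the support of `u_i`. -/
def UniversalForWCBBS {J : Type*} (B : UncondBasis X J) : Prop :=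
  ∀ (I : Type) (u : I → X),
    SemiNormalized u → IsBlockBasic B.coef u →
    (∃ ustar : I → (X →L[ℝ] ℝ), IsGoodProjecting B.vec B.coef u ustar) →
    ∃ π : I → J, Function.Injective π ∧ (∀ i, π i ∈ Supp B.coef (u i)) ∧
      FamiliesEquivalent u (fun i => B.vec (π i))

section Helpers

theorem hlp_mapCl {E G I : Type*} [NormedAddCommGroup E] [NormedSpace ℝ E]
    [NormedAddCommGroup G] [NormedSpace ℝ G] (x : I → E) {K : Type*} (z : K → G)
    (L : E →L[ℝ] G)
    (h : ∀ i, L (x i) ∈ closedSpan z) :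
    ∃ L' : closedSpan x →L[ℝ] closedSpan z, ∀ f, (L' f : G) = L f := by
  have key : ∀ f ∈ closedSpan x, L f ∈ closedSpan z := by
    have : closedSpan x ≤ (closedSpan z).comap (L : E →ₗ[ℝ] G) := by
      apply Submodule.topologicalClosure_minimal
      · rw [Submodule.span_le]
        rintro _ ⟨i, rfl⟩
        exact h i
      · exact (Submodule.isClosed_topologicalClosure _).preimage L.continuous
    exact fun f hf => this hf
  exact ⟨(L.comp (closedSpan x).subtypeL).codRestrict (closedSpan z) (fun f => key f f.2),
    fun f => rfl⟩

theorem hlp_ext {E G I : Type*} [NormedAddCommGroup E] [NormedSpace ℝ E]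
    [NormedAddCommGroup G] [NormedSpace ℝ G] (x : I → E) (L M : closedSpan x →L[ℝ] G)
    (h : ∀ i, L ⟨x i, mem_closedSpan x i⟩ = M ⟨x i, mem_closedSpan x i⟩) : L = M := by
  ext ⟨f, hf⟩
  have hf' : f ∈ closure (Submodule.span ℝ (Set.range x) : Set E) := hf
  have hcl : IsClosed {g : closedSpan x | L g = M g} := isClosed_eq L.continuous M.continuous
  have hsp : ∀ g (hg : g ∈ Submodule.span ℝ (Set.range x)),
      L ⟨g, Submodule.le_topologicalClosure _ hg⟩ = M ⟨g, Submodule.le_topologicalClosure _ hg⟩ := by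
    intro g hg
    induction hg using Submodule.span_induction with
    | mem g hg => obtain ⟨i, rfl⟩ := hg; exact h i
    | zero => exact (map_zero L).trans (map_zero M).symm
    | add a b ha hb h1 h2 =>
      have := congrArg₂ (· + ·) h1 h2
      simp only [← map_add] at this
      exact this
    | smul c a ha h1 =>
      have := congrArg (c • ·) h1
      simp only [← map_smul] at this
      exact this
  obtain ⟨s, hs, hlim⟩ := mem_closure_iff_seq_limit.1 hf'
  have : Filter.Tendsto (fun n => (⟨s n, Submodule.le_topologicalClosure _ (hs n)⟩ : closedSpan x))
      Filter.atTop (nhds ⟨f, hf⟩) := by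
    rw [tendsto_subtype_rng]; exact hlim
  exact hcl.mem_of_tendsto this (Filter.Eventually.of_forall fun n => hsp _ (hs n))

theorem hlp_equiv {E G I : Type*} [NormedAddCommGroup E] [NormedSpace ℝ E]
    [NormedAddCommGroup G] [NormedSpace ℝ G] (x : I → E) (y : I → G)
    (S : closedSpan x →L[ℝ] G) (R : closedSpan y →L[ℝ] E)
    (hS : ∀ i, S ⟨x i, mem_closedSpan x i⟩ = y i) (hR : ∀ i, R ⟨y i, mem_closedSpan y i⟩ = x i) :
    FamiliesEquivalent x y := by
  have kS : ∀ f, S f ∈ closedSpan y := by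
    rintro ⟨f, hf⟩
    have hf' : f ∈ closure (Submodule.span ℝ (Set.range x) : Set E) := hf
    have hsp : ∀ g (hg : g ∈ Submodule.span ℝ (Set.range x)),
        S ⟨g, Submodule.le_topologicalClosure _ hg⟩ ∈ closedSpan y := by
      intro g hg
      induction hg using Submodule.span_induction with
      | mem g hg => obtain ⟨i, rfl⟩ := hg; rw [hS i]; exact mem_closedSpan y i
      | zero => exact (map_zero S) ▸ Submodule.zero_mem _
      | add a b ha hb h1 h2 =>
        have := Submodule.add_mem _ h1 h2
        rw [← map_add] at this
        exact this
      | smul c a ha h1 =>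
        have := Submodule.smul_mem _ c h1
        rw [← map_smul] at this
        exact this
    obtain ⟨s, hs, hlim⟩ := mem_closure_iff_seq_limit.1 hf'
    have : Filter.Tendsto (fun n => (⟨s n, Submodule.le_topologicalClosure _ (hs n)⟩ : closedSpan x))
        Filter.atTop (nhds ⟨f, hf⟩) := by
      rw [tendsto_subtype_rng]; exact hlim
    have hc : IsClosed (closedSpan y : Set G) := Submodule.isClosed_topologicalClosure _
    exact hc.mem_of_tendsto ((S.continuous.tendsto _).comp this)
      (Filter.Eventually.of_forall fun n => hsp _ (hs n))
  have kR : ∀ f, R f ∈ closedSpan x := by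
    rintro ⟨f, hf⟩
    have hf' : f ∈ closure (Submodule.span ℝ (Set.range y) : Set G) := hf
    have hsp : ∀ g (hg : g ∈ Submodule.span ℝ (Set.range y)),
        R ⟨g, Submodule.le_topologicalClosure _ hg⟩ ∈ closedSpan x := by
      intro g hg
      induction hg using Submodule.span_induction with
      | mem g hg => obtain ⟨i, rfl⟩ := hg; rw [hR i]; exact mem_closedSpan x i
      | zero => exact (map_zero R) ▸ Submodule.zero_mem _
      | add a b ha hb h1 h2 =>
        have := Submodule.add_mem _ h1 h2
        rw [← map_add] at this
        exact this
      | smul c a ha h1 =>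
        have := Submodule.smul_mem _ c h1
        rw [← map_smul] at this
        exact this
    obtain ⟨s, hs, hlim⟩ := mem_closure_iff_seq_limit.1 hf'
    have : Filter.Tendsto (fun n => (⟨s n, Submodule.le_topologicalClosure _ (hs n)⟩ : closedSpan y))
        Filter.atTop (nhds ⟨f, hf⟩) := by
      rw [tendsto_subtype_rng]; exact hlim
    have hc : IsClosed (closedSpan x : Set E) := Submodule.isClosed_topologicalClosure _
    exact hc.mem_of_tendsto ((R.continuous.tendsto _).comp this)
      (Filter.Eventually.of_forall fun n => hsp _ (hs n))
  let S' := S.codRestrict (closedSpan y) kS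
  let R' := R.codRestrict (closedSpan x) kR
  have hS' : ∀ i, S' ⟨x i, mem_closedSpan x i⟩ = ⟨y i, mem_closedSpan y i⟩ :=
    fun i => Subtype.ext (hS i)
  have hR' : ∀ i, R' ⟨y i, mem_closedSpan y i⟩ = ⟨x i, mem_closedSpan x i⟩ :=
    fun i => Subtype.ext (hR i)
  have h1 : R'.comp S' = ContinuousLinearMap.id ℝ _ := by
    apply hlp_ext; intro i; simp [hS', hR']
  have h2 : S'.comp R' = ContinuousLinearMap.id ℝ _ := by
    apply hlp_ext; intro i; simp [hS', hR']
  refine ⟨ContinuousLinearEquiv.equivOfInverse S' R' (fun f => ?_) (fun f => ?_), fun j => ?_⟩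
  · exact DFunLike.congr_fun h1 f
  · exact DFunLike.congr_fun h2 f
  · exact hS j

theorem hlp_bound {E I : Type*} [NormedAddCommGroup E] [NormedSpace ℝ E] (x : I → E) (a : I → ℝ)
    (M ε : ℝ) (hM : ∀ i, |a i| ≤ M) (hM0 : 0 ≤ M) (hε : 0 ≤ ε) (A : Finset I)
    (h : ∀ D ⊆ A, ‖∑ i ∈ D, x i‖ ≤ ε) : ‖∑ i ∈ A, a i • x i‖ ≤ 2 * M * ε := by
  apply NormedSpace.norm_le_dual_bound ℝ _ (by positivity)
  intro g
  have hD : ∀ D ⊆ A, |∑ i ∈ D, g (x i)| ≤ ‖g‖ * ε := by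
    intro D hD
    rw [← map_sum, ← Real.norm_eq_abs]
    exact (g.le_opNorm _).trans (by gcongr; exact h D hD)
  have h1 : ∑ i ∈ A, |g (x i)| ≤ 2 * (‖g‖ * ε) := by
    rw [← Finset.sum_filter_add_sum_filter_not A (fun i => 0 ≤ g (x i))]
    have e1 : ∑ i ∈ A with 0 ≤ g (x i), |g (x i)| = ∑ i ∈ A with 0 ≤ g (x i), g (x i) :=
      Finset.sum_congr rfl fun i hi => abs_of_nonneg (Finset.mem_filter.1 hi).2
    have e2 : ∑ i ∈ A with ¬ 0 ≤ g (x i), |g (x i)| = - ∑ i ∈ A with ¬ 0 ≤ g (x i), g (x i) := by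
      rw [← Finset.sum_neg_distrib]
      exact Finset.sum_congr rfl fun i hi => abs_of_neg (not_le.1 (Finset.mem_filter.1 hi).2)
    rw [e1, e2]
    have := (abs_le.1 (hD _ (Finset.filter_subset (fun i => 0 ≤ g (x i)) A))).2
    have := (abs_le.1 (hD _ (Finset.filter_subset (fun i => ¬ 0 ≤ g (x i)) A))).1
    linarith
  calc ‖g (∑ i ∈ A, a i • x i)‖ = |∑ i ∈ A, a i * g (x i)| := by simp [map_sum]
    _ ≤ ∑ i ∈ A, |a i * g (x i)| := Finset.abs_sum_le_sum_abs _ _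
    _ ≤ ∑ i ∈ A, M * |g (x i)| := by
        apply Finset.sum_le_sum; intro i _; rw [abs_mul]; gcongr; exact hM i
    _ = M * ∑ i ∈ A, |g (x i)| := by rw [Finset.mul_sum]
    _ ≤ M * (2 * (‖g‖ * ε)) := by gcongr
    _ = 2 * M * ε * ‖g‖ := by ring

theorem hlp_summable {E I : Type*} [NormedAddCommGroup E] [NormedSpace ℝ E] [CompleteSpace E]
    (x : I → E) (hx : Summable x) (a : I → ℝ)
    (M : ℝ) (hM : ∀ i, |a i| ≤ M) : Summable fun i => a i • x i := by
  have hM' : ∀ i, |a i| ≤ |M| := fun i => (hM i).trans (le_abs_self _)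
  rw [summable_iff_vanishing_norm] at hx ⊢
  intro ε hε
  have hp : 0 < 2 * |M| + 1 := by positivity
  obtain ⟨s, hs⟩ := hx (ε / (2 * |M| + 1)) (by positivity)
  refine ⟨s, fun t ht => ?_⟩
  have := hlp_bound x a |M| (ε / (2 * |M| + 1)) hM' (abs_nonneg _) (by positivity) t
    (fun D hD => (hs D (ht.mono_left hD)).le)
  refine this.trans_lt ?_
  rw [mul_div_assoc', div_lt_iff₀ hp]
  nlinarith

theorem hlp_sumbdd {E I : Type*} [NormedAddCommGroup E] [NormedSpace ℝ E]
    (x : I → E) (hx : Summable x) : ∃ K, ∀ A : Finset I, ‖∑ i ∈ A, x i‖ ≤ K := by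
  obtain ⟨s, hs⟩ := (cauchySeq_finset_iff_vanishing_norm.1 hx.hasSum.cauchySeq) 1 one_pos
  refine ⟨∑ i ∈ s, ‖x i‖ + 1, fun A => ?_⟩
  rw [← Finset.sum_inter_add_sum_sdiff A s]
  refine (norm_add_le _ _).trans (add_le_add ?_ (hs _ Finset.sdiff_disjoint).le)
  refine (norm_sum_le _ _).trans ?_
  exact Finset.sum_le_sum_of_subset_of_nonneg Finset.inter_subset_right (fun _ _ _ => norm_nonneg _)

theorem hlp_op {E G I : Type*} [NormedAddCommGroup E] [NormedSpace ℝ E] [CompleteSpace E]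
    [NormedAddCommGroup G] [NormedSpace ℝ G] (u : I → G) (us : I → (E →L[ℝ] ℝ))
    (h : ∀ f, Summable fun i => us i f • u i) :
    ∃ K : ℝ, (∀ i f, ‖us i f • u i‖ ≤ K * ‖f‖) ∧
      ∃ Q : E →L[ℝ] G, ∀ f, HasSum (fun i => us i f • u i) (Q f) := by
  let T : Finset I → (E →L[ℝ] G) := fun A => ∑ i ∈ A, (us i).smulRight (u i)
  have hT : ∀ A f, T A f = ∑ i ∈ A, us i f • u i := by
    intro A f; simp [T]
  obtain ⟨K, hK⟩ := banach_steinhaus (g := T) (fun f => by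
    obtain ⟨K, hK⟩ := hlp_sumbdd _ (h f)
    exact ⟨K, fun A => by rw [hT]; exact hK A⟩)
  have hK' : ∀ A f, ‖∑ i ∈ A, us i f • u i‖ ≤ K * ‖f‖ := by
    intro A f
    rw [← hT]
    exact (T A).le_of_opNorm_le (hK A) f
  refine ⟨K, fun i f => by simpa using hK' {i} f, ?_⟩
  let Q : E →ₗ[ℝ] G :=
    { toFun := fun f => ∑' i, us i f • u i
      map_add' := fun f g => by
        simp only [map_add, add_smul]
        exact (h f).tsum_add (h g)
      map_smul' := fun c f => by
        simp only [map_smul, smul_assoc, RingHom.id_apply]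
        exact (h f).tsum_const_smul c }
  refine ⟨Q.mkContinuous K (fun f => ?_), fun f => (h f).hasSum⟩
  exact le_of_tendsto (h f).hasSum.norm (Filter.Eventually.of_forall fun A => hK' A f)

end Helpers

section Main

theorem hlp_main
    {F : Type} [Fintype F] [DecidableEq F] {E : Type} [NormedAddCommGroup E] [NormedSpace ℝ E]
    [CompleteSpace E]
    (X : F → Type) [∀ i, NormedAddCommGroup (X i)] [∀ i, NormedSpace ℝ (X i)]
    (J : F → Type) (B : ∀ i : F, UncondBasis (X i) (J i))
    (hB : ∀ i, UniversalForWCBBS (B i))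
    (C : UncondBasis E (Σ i : F, J i))
    (P : ∀ t, E →L[ℝ] X t) (ι : ∀ t, X t →L[ℝ] E)
    (hP : ∀ t f, ‖P t f‖ ≤ ‖f‖)
    (hι : ∀ t f, ‖ι t f‖ ≤ ‖f‖)
    (hPι : ∀ t f, P t (ι t f) = f)
    (hPι' : ∀ t s f, s ≠ t → P t (ι s f) = 0)
    (hsum : ∀ f, ∑ t, ι t (P t f) = f)
    (hvec : ∀ (i : F) (j : J i), C.vec ⟨i, j⟩ = ι i ((B i).vec j))
    (hcoef : ∀ (i : F) (j : J i) (f : E), C.coef ⟨i, j⟩ f = (B i).coef j (P i f)) :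
    UniversalForWCBBS C := by
  rintro I u ⟨c, c', hc, hu⟩ ⟨hu0, hufin, hudisj⟩ ⟨us, hsupp, hbi, ⟨P0, hP0⟩⟩
  -- norms of functionals
  obtain ⟨K, hK, -⟩ := hlp_op u us (fun f => (hP0 f).summable)
  -- choice of coordinates
  have hN : (0 : ℝ) < (Fintype.card F : ℝ) + 1 := by positivity
  have hch : ∀ i, ∃ t, ((Fintype.card F : ℝ) + 1)⁻¹ ≤ |us i (ι t (P t (u i)))| := by
    intro i
    by_contra! hcon
    have h1 : (1 : ℝ) = ∑ t, us i (ι t (P t (u i))) := by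
      rw [← map_sum, hsum, hbi]; simp
    have h2 : (1 : ℝ) ≤ Fintype.card F * ((Fintype.card F : ℝ) + 1)⁻¹ := by
      calc (1 : ℝ) ≤ |∑ t, us i (ι t (P t (u i)))| := by rw [← h1]; simp
        _ ≤ ∑ t, |us i (ι t (P t (u i)))| := Finset.abs_sum_le_sum_abs _ _
        _ ≤ ∑ t : F, ((Fintype.card F : ℝ) + 1)⁻¹ := Finset.sum_le_sum fun t _ => (hcon t).le
        _ = _ := by simp
    rw [← div_eq_mul_inv, le_div_iff₀ hN] at h2
    linarith
  choose s hs using hch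
  set lam : I → ℝ := fun i => us i (ι (s i) (P (s i) (u i))) with hlam
  have hlam0 : ∀ i, lam i ≠ 0 := fun i h0 => by
    have := hs i
    rw [show us i (ι (s i) (P (s i) (u i))) = 0 from h0, abs_zero] at this
    exact absurd this (not_le.2 (inv_pos.2 hN))
  have hlaminv : ∀ i, |(lam i)⁻¹| ≤ (Fintype.card F : ℝ) + 1 := fun i => by
    rw [abs_inv]
    exact inv_le_of_inv_le₀ hN (hs i)
  -- biorthogonality after projection
  have hzero : ∀ i k t, i ≠ k → us i (ι t (P t (u k))) = 0 := by
    intro i k t hik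
    have h1 := ((B t).expansion (P t (u k))).mapL ((us i).comp (ι t))
    refine h1.unique ?_
    convert hasSum_zero using 1
    funext j
    simp only [map_smul, ContinuousLinearMap.comp_apply, smul_eq_mul]
    by_contra hne
    have hn := mul_ne_zero_iff.1 hne
    have hdj : Disjoint (Supp C.coef (u i)) (Supp C.coef (u k)) := hudisj hik
    refine (Set.disjoint_left.1 hdj : _) (hsupp i (?_ : (⟨t, j⟩ : Σ i, J i) ∈ _)) ?_
    · change us i (C.vec ⟨t, j⟩) ≠ 0
      rw [hvec]; exact hn.2
    · change C.coef ⟨t, j⟩ (u k) ≠ 0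
      rw [hcoef]; exact hn.1
  -- multiplier operators
  have hmult : ∀ (a : I → ℝ) (M : ℝ), (∀ i, |a i| ≤ M) →
      ∃ Q : E →L[ℝ] E, ∀ f, HasSum (fun i => a i • us i f • u i) (Q f) := by
    intro a M ha
    obtain ⟨-, -, Q, hQ⟩ := hlp_op u (fun i => a i • us i) (fun f => by
      have := hlp_summable _ (hP0 f).summable a M ha
      simpa [smul_smul] using this)
    refine ⟨Q, fun f => ?_⟩
    simpa [smul_smul] using hQ f
  have hQ := fun t => hmult (fun i => if s i = t then (lam i)⁻¹ else 0)
    ((Fintype.card F : ℝ) + 1) (fun i => by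
      split_ifs
      · exact hlaminv i
      · simpa using hN.le)
  choose Q hQ using hQ
  have hR := fun t => hmult (fun i => if s i = t then 1 else 0) 1 (fun i => by
      split_ifs <;> simp)
  choose R hR using hR
  have hQv : ∀ t k, s k = t → Q t (ι t (P t (u k))) = u k := by
    rintro t k rfl
    refine (hQ _ _).unique ?_
    convert hasSum_single k (fun i hi => ?_) using 1
    · simp only [if_true]
      rw [smul_smul, inv_mul_cancel₀ (hlam0 k), one_smul]
    · rw [hzero i k _ hi]; simp
  have hRu : ∀ t k, R t (u k) = if s k = t then u k else 0 := by
    intro t k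
    refine (hR _ _).unique ?_
    convert hasSum_single k (fun i hi => ?_) using 1
    · simp [hbi]
    · simp [hbi, hi]
  -- the pieces
  have hpiece : ∀ t, ∃ π : {i // s i = t} → J t, Function.Injective π ∧
      (∀ i : {i // s i = t}, π i ∈ Supp (B t).coef (P t (u i))) ∧
      FamiliesEquivalent (fun i : {i // s i = t} => P t (u i)) (fun i => (B t).vec (π i)) := by
    intro t
    have hlow : ∀ i, s i = t → 0 < ‖P t (u i)‖ ∧
        c * ((Fintype.card F : ℝ) + 1)⁻¹ / (|K| + 1) ≤ ‖P t (u i)‖ := by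
      rintro i rfl
      have hb : c * ((Fintype.card F : ℝ) + 1)⁻¹ ≤ (|K| + 1) * ‖P (s i) (u i)‖ := by
        calc c * ((Fintype.card F : ℝ) + 1)⁻¹ ≤ ‖u i‖ * |us i (ι (s i) (P (s i) (u i)))| :=
              mul_le_mul (hu i).1 (hs i) (inv_pos.2 hN).le (norm_nonneg _)
          _ = ‖us i (ι (s i) (P (s i) (u i))) • u i‖ := by
              rw [norm_smul, Real.norm_eq_abs, mul_comm]
          _ ≤ K * ‖ι (s i) (P (s i) (u i))‖ := hK _ _
          _ ≤ (|K| + 1) * ‖ι (s i) (P (s i) (u i))‖ := by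
              gcongr; linarith [le_abs_self K]
          _ ≤ _ := by gcongr; exact hι _ _
      have hb' : c * ((Fintype.card F : ℝ) + 1)⁻¹ / (|K| + 1) ≤ ‖P (s i) (u i)‖ := by
        rw [div_le_iff₀ (by positivity)]; linarith
      exact ⟨lt_of_lt_of_le (by positivity) hb', hb'⟩
    have hsuppP : ∀ i j, j ∈ Supp (B t).coef (P t (u i)) ↔ (⟨t, j⟩ : Σ i, J i) ∈ Supp C.coef (u i) := by
      intro i j
      change (B t).coef j _ ≠ 0 ↔ C.coef ⟨t, j⟩ _ ≠ 0
      rw [hcoef]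
    apply hB t {i // s i = t} (fun i => P t (u i))
    · exact ⟨c * ((Fintype.card F : ℝ) + 1)⁻¹ / (|K| + 1), c', by positivity,
        fun i => ⟨(hlow i i.2).2, (hP _ _).trans (hu i).2⟩⟩
    · refine ⟨fun i => norm_pos_iff.1 (hlow i i.2).1, fun i => ?_, fun i k hik => ?_⟩
      · have := (hufin i).preimage (f := fun j : J t => (⟨t, j⟩ : Σ i, J i))
          (sigma_mk_injective.injOn)
        refine this.subset fun j hj => (hsuppP _ _).1 hj
      · refine Set.disjoint_left.2 ?_
        intro j hj hj'
        exact Set.disjoint_left.1 (hudisj (fun h => hik (Subtype.ext h)))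
          ((hsuppP _ _).1 hj) ((hsuppP _ _).1 hj')
    · refine ⟨fun i => (lam i)⁻¹ • (us i).comp (ι t), fun i j hj => ?_, fun i k => ?_,
        (P t).comp ((Q t).comp (ι t)), fun f => ?_⟩
      · rw [hsuppP]
        apply hsupp
        change us i (C.vec ⟨t, j⟩) ≠ 0
        rw [hvec]
        have hj' : (lam i)⁻¹ * us i (ι t ((B t).vec j)) ≠ 0 := hj
        exact (mul_ne_zero_iff.1 hj').2
      · change (lam i)⁻¹ * us i (ι t (P t (u k))) = _
        split_ifs with h
        · subst h
          obtain ⟨i, rfl⟩ := i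
          exact inv_mul_cancel₀ (hlam0 i)
        · rw [hzero _ _ _ (fun h' => h (Subtype.ext h')), mul_zero]
      · have h1 := (hQ t (ι t f)).mapL (P t)
        have h2 := (hasSum_subtype_iff_of_support_subset (s := {i | s i = t}) (by
          intro i hi
          by_contra hne
          have hne' : ¬ s i = t := hne
          simp [hne'] at hi)).2 h1
        refine Eq.subst (motive := fun g : {i // s i = t} → X t => HasSum g _)
          (funext fun i => ?_) h2
        have hi : s i = t := i.2
        simp [hi, smul_smul]
  choose π hπinj hπsupp T hT using hpiece
  have hvecπ : ∀ i, C.vec ⟨s i, π (s i) ⟨i, rfl⟩⟩ = ι (s i) ((B (s i)).vec (π (s i) ⟨i, rfl⟩)) :=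
    fun i => hvec _ _
  refine ⟨fun i => ⟨s i, π (s i) ⟨i, rfl⟩⟩, ?_, ?_, ?_⟩
  · intro i k hik
    by_contra hne
    have h1 : ∀ i, (⟨s i, π (s i) ⟨i, rfl⟩⟩ : Σ i, J i) ∈ Supp C.coef (u i) := by
      intro i
      have := hπsupp (s i) ⟨i, rfl⟩
      change C.coef _ _ ≠ 0
      rw [hcoef]; exact this
    have h2 := h1 i
    have h3 := h1 k
    simp only at hik
    rw [hik] at h2
    exact Set.disjoint_left.1 (hudisj hne) h2 h3
  · intro i
    have := hπsupp (s i) ⟨i, rfl⟩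
    change C.coef _ _ ≠ 0
    rw [hcoef]; exact this
  · set w : I → E := fun i => C.vec ⟨s i, π (s i) ⟨i, rfl⟩⟩ with hw
    have hA := fun t => hlp_mapCl u (fun i : {i // s i = t} => P t (u i)) ((P t).comp (R t))
      (fun i => by
        rw [ContinuousLinearMap.comp_apply, hRu]
        split_ifs with h
        · exact mem_closedSpan (fun i : {i // s i = t} => P t (u i)) ⟨i, h⟩
        · rw [map_zero]; exact Submodule.zero_mem _)
    choose A hA using hA
    have hPw : ∀ t i, (h : s i = t) → P t (w i) = (B t).vec (π t ⟨i, h⟩) := by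
      rintro t i rfl
      rw [hw]; simp only; rw [hvec, hPι]
    have hPw' : ∀ t i, s i ≠ t → P t (w i) = 0 := by
      intro t i h
      rw [hw]; simp only; rw [hvec, hPι' _ _ _ h]
    have hD := fun t => hlp_mapCl w (fun i : {i // s i = t} => (B t).vec (π t i)) (P t)
      (fun i => by
        by_cases h : s i = t
        · rw [hPw t i h]
          exact mem_closedSpan (fun i : {i // s i = t} => (B t).vec (π t i)) ⟨i, h⟩
        · rw [hPw' t i h]; exact Submodule.zero_mem _)
    choose D hD using hD
    refine hlp_equiv u w
      (∑ t, (ι t).comp ((closedSpan _).subtypeL.comp ((T t).toContinuousLinearMap.comp (A t))))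
      (∑ t, (Q t).comp ((ι t).comp ((closedSpan _).subtypeL.comp
        (((T t).symm.toContinuousLinearMap).comp (D t))))) (fun i => ?_) (fun i => ?_)
    · rw [_root_.sum_apply, Finset.sum_eq_single (s i)]
      · have : A (s i) ⟨u i, mem_closedSpan u i⟩ = ⟨P (s i) (u i),
            mem_closedSpan (fun k : {k // s k = s i} => P (s i) (u k)) ⟨i, rfl⟩⟩ := by
          apply Subtype.ext
          rw [hA]; simp [hRu]
        simp only [ContinuousLinearMap.comp_apply, this, Submodule.subtypeL_apply,
          ContinuousLinearEquiv.coe_coe]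
        rw [hT (s i) ⟨i, rfl⟩]
        exact (hvecπ i).symm
      · intro t _ ht
        have : A t ⟨u i, mem_closedSpan u i⟩ = 0 := by
          apply Subtype.ext
          rw [hA]; simp [hRu, Ne.symm ht]
        simp [this]
      · simp
    · rw [_root_.sum_apply, Finset.sum_eq_single (s i)]
      · have : D (s i) ⟨w i, mem_closedSpan w i⟩ = T (s i) ⟨P (s i) (u i),
            mem_closedSpan (fun k : {k // s k = s i} => P (s i) (u k)) ⟨i, rfl⟩⟩ := by
          apply Subtype.ext
          rw [hD, hT (s i) ⟨i, rfl⟩]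
          exact hPw _ _ rfl
        simp only [ContinuousLinearMap.comp_apply, this, Submodule.subtypeL_apply,
          ContinuousLinearEquiv.coe_coe, ContinuousLinearEquiv.symm_apply_apply]
        exact hQv _ _ rfl
      · intro t _ ht
        have : D t ⟨w i, mem_closedSpan w i⟩ = 0 := by
          apply Subtype.ext
          rw [hD]; simp [hPw' t i (Ne.symm ht)]
        simp [this]
      · simp

end Main

/-- If each member of a finite family of unconditional bases is universal for
well complemented block basic sequences, then so is the direct-sum basis of the direct sum
(with the sup norm), i.e., the basis whose `(i,j)`-th member is the `j`-th basis vector of the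
`i`-th space placed in the `i`-th coordinate, with coordinatewise coefficient functionals. -/
theorem directSum_universal_for_well_complemented_block_basic_sequences
    {F : Type} [Fintype F] [DecidableEq F]
    (X : F → Type) [∀ i, NormedAddCommGroup (X i)] [∀ i, NormedSpace ℝ (X i)]
    [∀ i, CompleteSpace (X i)]
    (J : F → Type) (B : ∀ i : F, UncondBasis (X i) (J i))
    (hB : ∀ i, UniversalForWCBBS (B i))
    (C : UncondBasis (PiLp ⊤ X) (Σ i : F, J i))
    (hvec : ∀ (i : F) (j : J i),
      C.vec ⟨i, j⟩ = (WithLp.equiv ⊤ (∀ i, X i)).symm (Pi.single i ((B i).vec j)))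
    (hcoef : ∀ (i : F) (j : J i) (f : PiLp ⊤ X),
      C.coef ⟨i, j⟩ f = (B i).coef j ((WithLp.equiv ⊤ (∀ i, X i)) f i)) :
    UniversalForWCBBS C := by
  refine hlp_main X J B hB C (fun t => PiLp.proj ⊤ X t)
    (fun t => ((PiLp.continuousLinearEquiv ⊤ ℝ X).symm : (∀ i, X i) →L[ℝ] PiLp ⊤ X).comp
      (ContinuousLinearMap.single ℝ X t)) ?_ ?_ ?_ ?_ ?_ ?_ ?_
  · intro t f
    exact PiLp.norm_apply_le f t
  · intro t f
    rw [PiLp.norm_eq_ciSup]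
    refine Real.iSup_le (fun i => ?_) (norm_nonneg _)
    by_cases h : i = t
    · subst h; simp
    · simp [h]
  · intro t f; simp
  · intro t s f h; simp [Ne.symm h]
  · intro f
    ext t
    simp [Finset.sum_apply]
  · intro i j
    rw [hvec]; rfl
  · intro i j f
    rw [hcoef]; rfl

end
end
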